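/- Let s ≥ 1. There exists a constant c > 0 (depending only on s) such that for every divergence-free Schwartz vector field u : ℝ³ → ℝ³, |⟨Λ^s[(u·∇)u], Λ^s u⟩_{L²}| ≤ c·‖u‖_{Ḣ^s}·‖u‖_{Ḣ^{s+1}}·‖u‖_{Ḣ^{3/2}}. -/

import Mathlib

open MeasureTheory Filter SchwartzMap
open scoped FourierTransform

noncomputable section

abbrev Ell (n : ℕ) := EuclideanSpace ℝ (Fin n)

def eVec (n : ℕ) (i : Fin n) : Ell n := EuclideanSpace.single i 1

/-- coercion of a real-valued function to a complex-valued one -/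
def cf {n : ℕ} (f : Ell n → ℝ) : Ell n → ℂ := fun x => (f x : ℂ)

/-- the Fourier multiplier operator `Λ^s` with symbol `|ξ|^s` -/
def Lam {n : ℕ} (s : ℝ) (f : Ell n → ℂ) : Ell n → ℂ :=
  𝓕⁻ (fun ξ => ((‖ξ‖ ^ s : ℝ) : ℂ) * 𝓕 f ξ)

/-- the partial derivative `∂ᵢ` -/
def pd {n : ℕ} (i : Fin n) (f : Ell n → ℂ) : Ell n → ℂ :=
  fun x => fderiv ℝ f x (eVec n i)

/-- the advection term `(v·∇)w` for complex vector fields -/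
def adv {n : ℕ} (v w : Fin n → Ell n → ℂ) : Fin n → Ell n → ℂ :=
  fun l x => ∑ i, v i x * pd i (w l) x

/-- squared homogeneous Sobolev norm of a complex scalar function -/
def HsqC {n : ℕ} (s : ℝ) (f : Ell n → ℂ) : ℝ :=
  ∫ ξ, ‖ξ‖ ^ (2 * s) * ‖𝓕 f ξ‖ ^ 2

/-- homogeneous Sobolev norm `‖u‖_{Ḣ^s}` of a real vector field -/
def Hnorm {n : ℕ} (s : ℝ) (u : Fin n → Ell n → ℝ) : ℝ :=
  Real.sqrt (∑ l, HsqC s (cf (u l)))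

/-- `L²` norm of a complex vector field -/
def vL2 {n : ℕ} (f : Fin n → Ell n → ℂ) : ℝ :=
  Real.sqrt (∑ l, ∫ x, ‖f l x‖ ^ 2)

/-- `L²` pairing `⟨f,g⟩ = Σ_l ∫ f_l g_l` of complex vector fields -/
def Cinner {n : ℕ} (f g : Fin n → Ell n → ℂ) : ℂ :=
  ∑ l, ∫ x, f l x * g l x

/-- A vector field is divergence free: `Σᵢ ∂ᵢuᵢ = 0`. -/
def DivFree {n : ℕ} (u : Fin n → 𝓢(Ell n, ℝ)) : Prop :=
  ∀ x, ∑ i, fderiv ℝ (fun y => u i y) x (eVec n i) = 0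

section FourierPairing

variable {E : Type*} [NormedAddCommGroup E] [InnerProductSpace ℝ E] [FiniteDimensional ℝ E]
  [MeasurableSpace E] [BorelSpace E]

/-- The inverse Fourier transform is self-adjoint for the bilinear pairing of `L¹` functions. -/
theorem integral_smul_fourierInv_eq {f g : E → ℂ} (hf : Integrable f) (hg : Integrable g) :
    ∫ x, 𝓕⁻ f x • g x = ∫ x, f x • 𝓕⁻ g x := by
  have h := VectorFourier.integral_fourierIntegral_smul_eq_flip (L := -innerₗ E)
    (μ := (volume : Measure E)) (ν := (volume : Measure E))
    Real.continuous_fourierChar (by simpa using! continuous_inner.neg) hf hg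
  have hflip : (-innerₗ E : E →ₗ[ℝ] E →ₗ[ℝ] ℝ).flip = -innerₗ E := by
    ext x y
    simp [real_inner_comm]
  rw [hflip] at h
  exact h

/-- On `L¹ ∩ L²` the `L²` inverse Fourier transform is given by the Fourier integral. -/
theorem fourierInv_toLp_two_ae_eq {g : E → ℂ} (hg : Integrable g) (hg2 : MemLp g 2) :
    ((𝓕⁻ (hg2.toLp g) : Lp (α := E) ℂ 2 volume) : E → ℂ) =ᵐ[volume] 𝓕⁻ g := by
  have hcont : Continuous (𝓕⁻ g : E → ℂ) :=
    VectorFourier.fourierIntegral_continuous Real.continuous_fourierChar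
      (by simpa using! continuous_inner.neg) hg
  refine ae_eq_of_integral_contDiff_smul_eq ?_ hcont.locallyIntegrable ?_
  · exact (Lp.memLp (𝓕⁻ (hg2.toLp g) : Lp (α := E) ℂ 2 volume)).locallyIntegrable (by norm_num)
  intro φ hφ hφc
  have hφ' : ContDiff ℝ (⊤ : ℕ∞) (fun x => (φ x : ℂ)) := Complex.ofRealCLM.contDiff.comp hφ
  have hφc' : HasCompactSupport (fun x => (φ x : ℂ)) := hφc.comp_left Complex.ofReal_zero
  set Φ : 𝓢(E, ℂ) := hφc'.toSchwartzMap hφ' with hΦ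
  have hΦx : ∀ x, Φ x = (φ x : ℂ) := fun x => rfl
  have h := congrArg (fun T : 𝓢'(E, ℂ) => T Φ)
    (Lp.fourierInv_toTemperedDistribution_eq (hg2.toLp g))
  simp only [TemperedDistribution.fourierInv_apply, Lp.toTemperedDistribution_apply] at h
  have h2 : ∫ x, (𝓕⁻ Φ) x • (hg2.toLp g : E → ℂ) x = ∫ x, 𝓕⁻ (Φ : E → ℂ) x • g x := by
    refine integral_congr_ae ?_
    filter_upwards [hg2.coeFn_toLp] with x hx
    rw [hx, SchwartzMap.fourierInv_coe]
  rw [h2, integral_smul_fourierInv_eq Φ.integrable hg] at h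
  simpa [hΦx] using h.symm

/-- Plancherel's identity for the bilinear pairing of functions in `L¹ ∩ L²`. -/
theorem integral_fourierInv_mul_fourierInv {g h : E → ℂ} (hg : Integrable g) (hg2 : MemLp g 2)
    (hh : Integrable h) (hh2 : MemLp h 2) :
    ∫ x, 𝓕⁻ g x * 𝓕⁻ h x = ∫ ξ, g (-ξ) * h ξ := by
  set k : E → ℂ := fun ξ => starRingEnd ℂ (g (-ξ)) with hk
  have hk1 : Integrable k := by
    simpa [hk] using! (Complex.conjCLE.toContinuousLinearMap.integrable_comp hg.comp_neg)
  have hk2 : MemLp k 2 := by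
    have := (hg2.comp_measurePreserving (Measure.measurePreserving_neg volume)).star
    simpa [hk] using! this
  have hkg : ∀ x, 𝓕⁻ k x = starRingEnd ℂ (𝓕⁻ g x) := by
    intro x
    rw [Real.fourierInv_eq', Real.fourierInv_eq', ← integral_conj, ← integral_neg_eq_self]
    refine integral_congr_ae (Eventually.of_forall fun ξ => ?_)
    simp [hk, ← Complex.exp_conj, Complex.conj_ofNat]
  have key : inner ℂ (𝓕⁻ (hk2.toLp k)) (𝓕⁻ (hh2.toLp h)) = inner ℂ (hk2.toLp k) (hh2.toLp h) :=
    (Lp.fourierTransformₗᵢ E ℂ).symm.inner_map_map _ _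
  rw [L2.inner_def, L2.inner_def] at key
  calc ∫ x, 𝓕⁻ g x * 𝓕⁻ h x
      = ∫ x, inner ℂ ((𝓕⁻ (hk2.toLp k) : Lp (α := E) ℂ 2 volume) x)
          ((𝓕⁻ (hh2.toLp h) : Lp (α := E) ℂ 2 volume) x) := by
        refine integral_congr_ae ?_
        filter_upwards [fourierInv_toLp_two_ae_eq hk1 hk2, fourierInv_toLp_two_ae_eq hh hh2]
          with x h1 h2
        rw [h1, h2, hkg]
        simp [mul_comm]
    _ = _ := key
    _ = ∫ ξ, g (-ξ) * h ξ := by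
        refine integral_congr_ae ?_
        filter_upwards [hk2.coeFn_toLp, hh2.coeFn_toLp] with x h1 h2
        rw [h1, h2]
        simp [hk, mul_comm]

/-- The Fourier transform of a product of Schwartz functions is the convolution of their Fourier
transforms. -/
theorem fourier_schwartz_mul (f g : 𝓢(E, ℂ)) (ξ : E) :
    𝓕 (fun x => f x * g x) ξ = ∫ η, 𝓕 f (ξ - η) * 𝓕 g η := by
  have h := SchwartzMap.convolution_apply (ContinuousLinearMap.mul ℂ ℂ) (𝓕 g) (𝓕 f) ξ
  rw [convolution_def] at h
  simp only [ContinuousLinearMap.mul_apply'] at h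
  simp_rw [mul_comm (𝓕 f _)]
  rw [← h]
  change _ = 𝓕⁻ (pairing (ContinuousLinearMap.mul ℂ ℂ) (𝓕 (𝓕 g)) (𝓕 (𝓕 f))) ξ
  rw [SchwartzMap.fourierInv_coe, Real.fourierInv_eq_fourier_neg, Real.fourier_eq, Real.fourier_eq,
    ← integral_neg_eq_self]
  refine integral_congr_ae (Eventually.of_forall fun x => ?_)
  have hff : ∀ (k : 𝓢(E, ℂ)), 𝓕 (𝓕 k) x = k (-x) := by
    intro k
    rw [SchwartzMap.fourier_coe, ← neg_neg x, ← Real.fourierInv_eq_fourier_neg,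
      ← SchwartzMap.fourierInv_coe]
    simp
  simp [hff, mul_comm]

end FourierPairing

section Trilinear

/-- Cauchy–Schwarz for the lower Lebesgue integral. -/
theorem lintegral_mul_le_sqrt_mul_sqrt {α : Type*} [MeasurableSpace α] (μ : Measure α)
    {f g : α → ENNReal} (hf : AEMeasurable f μ) (hg : AEMeasurable g μ) :
    ∫⁻ x, f x * g x ∂μ ≤ (∫⁻ x, f x ^ 2 ∂μ) ^ (1 / 2 : ℝ) * (∫⁻ x, g x ^ 2 ∂μ) ^ (1 / 2 : ℝ) := by
  have h := ENNReal.lintegral_mul_le_Lp_mul_Lq μ Real.HolderConjugate.two_two hf hg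
  simpa using h

/-- The integral of `‖z‖⁻¹` over a ball of radius `r` in `ℝ³` is of order `r²`. -/
theorem lintegral_closedBall_inv_norm_le (r : ℝ) (hr : 0 ≤ r) :
    ∫⁻ z in Metric.closedBall (0 : Ell 3) r, ENNReal.ofReal ‖z‖⁻¹ ≤
      ENNReal.ofReal (3 * volume.real (Metric.ball (0 : Ell 3) 1) * r ^ 2) := by
  set f : ℝ → ℝ := (Set.Iic r).indicator fun y => y⁻¹ with hf
  have hdim : Module.finrank ℝ (Ell 3) - 1 = 2 := by simp
  have hEq : Set.EqOn (fun y : ℝ => y ^ (Module.finrank ℝ (Ell 3) - 1) • f y)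
      ((Set.Iic r).indicator id) (Set.Ioi 0) := by
    intro y hy
    have hy' : y ≠ 0 := ne_of_gt hy
    by_cases hyr : y ≤ r
    · simp [hf, hyr]
      field_simp
    · simp [hf, hyr]
  have hint : IntegrableOn ((Set.Iic r).indicator (id : ℝ → ℝ)) (Set.Ioi 0) := by
    rw [IntegrableOn, integrable_indicator_iff measurableSet_Iic, IntegrableOn,
      Measure.restrict_restrict measurableSet_Iic, Set.inter_comm, Set.Ioi_inter_Iic]
    exact (continuous_id.integrableOn_Icc).mono_set Set.Ioc_subset_Icc_self
  have hfi : Integrable (fun z : Ell 3 => f ‖z‖) := by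
    rw [integrable_fun_norm_addHaar volume (f := f), integrableOn_congr_fun hEq measurableSet_Ioi]
    exact hint
  have hf0 : ∀ z : Ell 3, 0 ≤ f ‖z‖ := fun z => by
    rw [hf]
    exact Set.indicator_apply_nonneg fun _ => by positivity
  have hval : ∫ z : Ell 3, f ‖z‖ ≤ 3 * volume.real (Metric.ball (0 : Ell 3) 1) * r ^ 2 := by
    rw [integral_fun_norm_addHaar volume f, setIntegral_congr_fun measurableSet_Ioi hEq,
      setIntegral_indicator measurableSet_Iic, Set.Ioi_inter_Iic,
      ← intervalIntegral.integral_of_le hr]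
    have h3 : Module.finrank ℝ (Ell 3) = 3 := by simp
    have hv : 0 ≤ volume.real (Metric.ball (0 : Ell 3) 1) := measureReal_nonneg
    simp only [h3, id, integral_id, smul_eq_mul, nsmul_eq_mul]
    push_cast
    nlinarith [mul_nonneg hv (sq_nonneg r)]
  calc ∫⁻ z in Metric.closedBall (0 : Ell 3) r, ENNReal.ofReal ‖z‖⁻¹
      = ∫⁻ z : Ell 3, ENNReal.ofReal (f ‖z‖) := by
        rw [← lintegral_indicator Metric.isClosed_closedBall.measurableSet]
        refine lintegral_congr fun z => ?_
        by_cases hz : ‖z‖ ≤ r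
        · simp [hf, hz]
        · simp [hf, hz]
    _ = ENNReal.ofReal (∫ z : Ell 3, f ‖z‖) :=
        (ofReal_integral_eq_lintegral_ofReal hfi (Eventually.of_forall hf0)).symm
    _ ≤ _ := ENNReal.ofReal_le_ofReal hval

/-- The kernel `‖z‖^{-1/2}`. -/
def halfKernel (z : Ell 3) : ENNReal := ENNReal.ofReal (‖z‖ ^ (-(1 / 2) : ℝ))

theorem measurable_halfKernel : Measurable halfKernel := by
  unfold halfKernel
  fun_prop

theorem halfKernel_neg (z : Ell 3) : halfKernel (-z) = halfKernel z := by
  simp [halfKernel]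

theorem halfKernel_sq (z : Ell 3) : halfKernel z ^ 2 = ENNReal.ofReal ‖z‖⁻¹ := by
  rw [halfKernel, ← ENNReal.ofReal_pow (by positivity), ← Real.rpow_natCast,
    ← Real.rpow_mul (norm_nonneg z)]
  norm_num [Real.rpow_neg_one]

/-- The constant of the trilinear estimate. -/
def trilinearConst : ℝ := Real.sqrt (12 * volume.real (Metric.ball (0 : Ell 3) 1))

theorem trilinear_half_le {A b : Ell 3 → ENNReal} (hA : Measurable A) (hb : Measurable b) :
    ∫⁻ ξ, ∫⁻ η, (if ‖η‖ ≤ ‖ξ‖ then A ξ * A η * (b (ξ - η) * halfKernel (ξ - η)) else 0) ≤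
      ENNReal.ofReal trilinearConst * (∫⁻ ξ, (ENNReal.ofReal ‖ξ‖ * A ξ) ^ 2) ^ (1 / 2 : ℝ) *
        ((∫⁻ ξ, A ξ ^ 2) ^ (1 / 2 : ℝ) * (∫⁻ ξ, b ξ ^ 2) ^ (1 / 2 : ℝ)) := by
  have hK := measurable_halfKernel
  set D : Ell 3 → ENNReal := fun ξ => ∫⁻ η, (A η * b (ξ - η)) ^ 2 with hD
  have hDm : Measurable D := by
    refine Measurable.lintegral_prod_right' (f := fun p : Ell 3 × Ell 3 =>
      (A p.2 * b (p.1 - p.2)) ^ 2) ?_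
    fun_prop
  have hDint : ∫⁻ ξ, D ξ = (∫⁻ ξ, A ξ ^ 2) * ∫⁻ ξ, b ξ ^ 2 := by
    rw [hD, lintegral_lintegral_swap (by fun_prop)]
    have : ∀ η : Ell 3, ∫⁻ ξ, (A η * b (ξ - η)) ^ 2 = A η ^ 2 * ∫⁻ ξ, b ξ ^ 2 := by
      intro η
      simp_rw [mul_pow]
      rw [lintegral_const_mul _ (by fun_prop), lintegral_sub_right_eq_self (fun z => b z ^ 2) η]
    simp_rw [this]
    rw [lintegral_mul_const _ (by fun_prop)]
  have hinner : ∀ ξ : Ell 3,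
      ∫⁻ η, (if ‖η‖ ≤ ‖ξ‖ then A ξ * A η * (b (ξ - η) * halfKernel (ξ - η)) else 0) ≤
        ENNReal.ofReal trilinearConst * ((ENNReal.ofReal ‖ξ‖ * A ξ) * D ξ ^ (1 / 2 : ℝ)) := by
    intro ξ
    have hker : ∫⁻ η, (if ‖ξ - η‖ ≤ 2 * ‖ξ‖ then halfKernel (ξ - η) else 0) ^ 2 ≤
        ENNReal.ofReal ((trilinearConst * ‖ξ‖) ^ 2) := by
      rw [lintegral_sub_left_eq_self
        (fun z => (if ‖z‖ ≤ 2 * ‖ξ‖ then halfKernel z else 0) ^ 2) ξ]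
      calc ∫⁻ z, (if ‖z‖ ≤ 2 * ‖ξ‖ then halfKernel z else 0) ^ 2
          = ∫⁻ z in Metric.closedBall (0 : Ell 3) (2 * ‖ξ‖), ENNReal.ofReal ‖z‖⁻¹ := by
            rw [← lintegral_indicator Metric.isClosed_closedBall.measurableSet]
            refine lintegral_congr fun z => ?_
            by_cases hz : ‖z‖ ≤ 2 * ‖ξ‖
            · simp [hz, halfKernel_sq]
            · simp [hz]
        _ ≤ _ := lintegral_closedBall_inv_norm_le _ (by positivity)
        _ = _ := by
            rw [mul_pow, mul_pow, trilinearConst, Real.sq_sqrt (by positivity)]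
            ring_nf
    have hm : Measurable fun η : Ell 3 =>
        (if ‖ξ - η‖ ≤ 2 * ‖ξ‖ then halfKernel (ξ - η) else 0) := by
      refine Measurable.ite ?_ (by fun_prop) measurable_const
      exact measurableSet_le (by fun_prop) (by fun_prop)
    calc ∫⁻ η, (if ‖η‖ ≤ ‖ξ‖ then A ξ * A η * (b (ξ - η) * halfKernel (ξ - η)) else 0)
        ≤ ∫⁻ η, A ξ * ((A η * b (ξ - η)) *
            (if ‖ξ - η‖ ≤ 2 * ‖ξ‖ then halfKernel (ξ - η) else 0)) := by
          refine lintegral_mono fun η => ?_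
          by_cases hη : ‖η‖ ≤ ‖ξ‖
          · have h2 : ‖ξ - η‖ ≤ 2 * ‖ξ‖ := by linarith [norm_sub_le ξ η]
            simp only [hη, h2, if_true]
            exact le_of_eq (by ring)
          · simp [hη]
      _ = A ξ * ∫⁻ η, ((A η * b (ξ - η)) *
            (if ‖ξ - η‖ ≤ 2 * ‖ξ‖ then halfKernel (ξ - η) else 0)) :=
          lintegral_const_mul _ (by fun_prop)
      _ ≤ A ξ * (D ξ ^ (1 / 2 : ℝ) * ENNReal.ofReal (trilinearConst * ‖ξ‖)) := by
          gcongr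
          refine (lintegral_mul_le_sqrt_mul_sqrt _ (by fun_prop) hm.aemeasurable).trans ?_
          gcongr
          calc _ ≤ ENNReal.ofReal ((trilinearConst * ‖ξ‖) ^ 2) ^ (1 / 2 : ℝ) := by gcongr
            _ = _ := by
              have h0 : 0 ≤ trilinearConst * ‖ξ‖ :=
                mul_nonneg (Real.sqrt_nonneg _) (norm_nonneg _)
              rw [ENNReal.ofReal_rpow_of_nonneg (by positivity) (by norm_num),
                ← Real.sqrt_eq_rpow, Real.sqrt_sq h0]
      _ = _ := by
          rw [ENNReal.ofReal_mul (show 0 ≤ trilinearConst from Real.sqrt_nonneg _)]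
          ring
  refine (lintegral_mono hinner).trans ?_
  rw [lintegral_const_mul _ (by fun_prop), mul_assoc]
  gcongr
  refine (lintegral_mul_le_sqrt_mul_sqrt _ (by fun_prop) (by fun_prop)).trans ?_
  gcongr
  rw [← ENNReal.mul_rpow_of_nonneg _ _ (by norm_num : (0 : ℝ) ≤ 1 / 2), ← hDint]
  refine le_of_eq (congrArg (· ^ (1 / 2 : ℝ)) (lintegral_congr fun ξ => ?_))
  rw [← ENNReal.rpow_natCast, ← ENNReal.rpow_mul]
  norm_num

/-- Fourier-side form of the estimate `|∫ f f g| ≤ C ‖∇f‖ ‖f‖ ‖g‖_{Ḣ^{1/2}}` on `ℝ³`. -/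
theorem trilinear_le {A b : Ell 3 → ENNReal} (hA : Measurable A) (hb : Measurable b)
    (hbneg : ∀ z, b (-z) = b z) :
    ∫⁻ ξ, ∫⁻ η, A ξ * A η * (b (ξ - η) * halfKernel (ξ - η)) ≤
      2 * (ENNReal.ofReal trilinearConst *
        (∫⁻ ξ, (ENNReal.ofReal ‖ξ‖ * A ξ) ^ 2) ^ (1 / 2 : ℝ) *
        ((∫⁻ ξ, A ξ ^ 2) ^ (1 / 2 : ℝ) * (∫⁻ ξ, b ξ ^ 2) ^ (1 / 2 : ℝ))) := by
  have hK := measurable_halfKernel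
  set G : Ell 3 → Ell 3 → ENNReal := fun ξ η =>
    (if ‖η‖ ≤ ‖ξ‖ then A ξ * A η * (b (ξ - η) * halfKernel (ξ - η)) else 0) with hG
  have hGm : Measurable (Function.uncurry G) := by
    refine Measurable.ite (measurableSet_le (by fun_prop) (by fun_prop)) ?_ measurable_const
    fun_prop
  have hle : ∀ ξ η, A ξ * A η * (b (ξ - η) * halfKernel (ξ - η)) ≤ G ξ η + G η ξ := by
    intro ξ η
    rcases le_total ‖η‖ ‖ξ‖ with h | h
    · refine le_trans ?_ le_self_add
      simp [hG, h]
    · refine le_trans ?_ le_add_self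
      have h1 : b (η - ξ) = b (ξ - η) := by rw [← hbneg, neg_sub]
      have h2 : halfKernel (η - ξ) = halfKernel (ξ - η) := by rw [← halfKernel_neg, neg_sub]
      simp only [hG, h, if_true, h1, h2]
      exact le_of_eq (by ring)
  calc ∫⁻ ξ, ∫⁻ η, A ξ * A η * (b (ξ - η) * halfKernel (ξ - η))
      ≤ ∫⁻ ξ, ∫⁻ η, (G ξ η + G η ξ) := lintegral_mono fun ξ => lintegral_mono fun η => hle ξ η
    _ = (∫⁻ ξ, ∫⁻ η, G ξ η) + ∫⁻ ξ, ∫⁻ η, G η ξ := by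
        have hGi : Measurable fun ξ => ∫⁻ η, G ξ η := hGm.lintegral_prod_right'
        rw [← lintegral_add_left hGi]
        exact lintegral_congr fun ξ => lintegral_add_left (hGm.of_uncurry_left) _
    _ = 2 * ∫⁻ ξ, ∫⁻ η, G ξ η := by
        rw [lintegral_lintegral_swap (f := fun ξ η => G η ξ)
          (hGm.comp measurable_swap).aemeasurable, two_mul]
    _ ≤ _ := by
        gcongr
        exact trilinear_half_le hA hb

end Trilinear

section Symbol

/-- The commutator bound for the symbol, in the case `y ≤ x`. -/
theorem rpow_two_mul_sub_mul_le_of_le {s x y z : ℝ} (hs : 1 ≤ s) (hy : 0 ≤ y) (hyx : y ≤ x)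
    (hxz : x ≤ y + z) (hz : 0 ≤ z) :
    (x ^ (2 * s) - y ^ (2 * s)) * y ≤
      s * 2 ^ s * (z * x ^ s * y ^ s + z ^ s * (x ^ s * y)) := by
  rcases hy.eq_or_lt with rfl | hy0
  · have : (0 : ℝ) ^ s = 0 := Real.zero_rpow (by linarith)
    simp [this]
  have hx0 : 0 < x := hy0.trans_le hyx
  have hpow : ∀ w : ℝ, 0 ≤ w → w * w ^ (s - 1) = w ^ s := by
    intro w hw
    rcases hw.eq_or_lt with rfl | hw
    · rw [zero_mul, Real.zero_rpow (by linarith)]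
    · rw [Real.rpow_sub_one hw.ne']
      field_simp
  have hmv : x ^ s - y ^ s ≤ s * z * x ^ (s - 1) := by
    have h := one_add_mul_self_le_rpow_one_add (s := y / x - 1) (by
      have : 0 ≤ y / x := by positivity
      linarith) hs
    have h' : (1 + (y / x - 1)) ^ s = y ^ s / x ^ s := by
      rw [add_sub_cancel, Real.div_rpow hy hx0.le]
    rw [h', le_div_iff₀ (by positivity)] at h
    have hxs : x ^ s = x * x ^ (s - 1) := (hpow x hx0.le).symm
    have h2 : (1 + s * (y / x - 1)) * x ^ s = x ^ s - s * (x - y) * x ^ (s - 1) := by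
      rw [hxs]
      field_simp
      ring
    have h3 : s * (x - y) * x ^ (s - 1) ≤ s * z * x ^ (s - 1) := by
      gcongr
      linarith
    linarith
  have hmax : x ^ (s - 1) ≤ 2 ^ (s - 1) * (y ^ (s - 1) + z ^ (s - 1)) := by
    have h1 : x ≤ 2 * max y z := by
      linarith [le_max_left y z, le_max_right y z]
    calc x ^ (s - 1) ≤ (2 * max y z) ^ (s - 1) :=
          Real.rpow_le_rpow hx0.le h1 (by linarith)
      _ = 2 ^ (s - 1) * (max y z) ^ (s - 1) :=
          Real.mul_rpow (by norm_num) (le_max_of_le_left hy)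
      _ ≤ _ := by
          gcongr
          rcases max_choice y z with h | h <;> rw [h]
          · linarith [Real.rpow_nonneg hz (s - 1)]
          · linarith [Real.rpow_nonneg hy (s - 1)]
  have hdiff : x ^ s - y ^ s ≤ s * 2 ^ (s - 1) * (z * y ^ (s - 1) + z ^ s) := by
    rw [← hpow z hz]
    calc _ ≤ s * z * x ^ (s - 1) := hmv
      _ ≤ s * z * (2 ^ (s - 1) * (y ^ (s - 1) + z ^ (s - 1))) := by gcongr
      _ = _ := by ring
  have hsq : ∀ w : ℝ, 0 ≤ w → w ^ (2 * s) = w ^ s * w ^ s := by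
    intro w hw
    rw [two_mul, Real.rpow_add_of_nonneg hw (by linarith) (by linarith)]
  have hmono : y ^ s ≤ x ^ s := Real.rpow_le_rpow hy hyx (by linarith)
  have h2s : (2 : ℝ) ^ s = 2 * 2 ^ (s - 1) := (hpow 2 (by norm_num)).symm
  calc (x ^ (2 * s) - y ^ (2 * s)) * y = (x ^ s - y ^ s) * (x ^ s + y ^ s) * y := by
        rw [hsq x hx0.le, hsq y hy]
        ring
    _ ≤ (s * 2 ^ (s - 1) * (z * y ^ (s - 1) + z ^ s)) * (x ^ s + x ^ s) * y := by
        gcongr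
    _ = s * 2 ^ s * (z * x ^ s * (y * y ^ (s - 1)) + z ^ s * (x ^ s * y)) := by
        rw [h2s]
        ring
    _ = _ := by rw [hpow y hy]

/-- The commutator bound for the symbol `|ξ|^{2s} - |η|^{2s}`. -/
theorem abs_rpow_two_mul_sub_mul_min_le {s x y z : ℝ} (hs : 1 ≤ s) (hx : 0 ≤ x) (hy : 0 ≤ y)
    (hz : |x - y| ≤ z) :
    |x ^ (2 * s) - y ^ (2 * s)| * min x y ≤
      s * 2 ^ s * (x ^ s * y ^ s * z + x ^ s * z ^ s * y + y ^ s * z ^ s * x) := by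
  have hz0 : 0 ≤ z := (abs_nonneg _).trans hz
  obtain ⟨h1, h2⟩ := abs_le.mp hz
  have hC : 0 ≤ s * 2 ^ s := by positivity
  rcases le_total y x with h | h
  · rw [min_eq_right h, abs_of_nonneg
      (sub_nonneg.mpr (Real.rpow_le_rpow hy h (by linarith)))]
    refine (rpow_two_mul_sub_mul_le_of_le hs hy h (by linarith) hz0).trans ?_
    refine mul_le_mul_of_nonneg_left ?_ hC
    have : 0 ≤ y ^ s * z ^ s * x := by positivity
    linarith
  · rw [min_eq_left h, abs_sub_comm, abs_of_nonneg
      (sub_nonneg.mpr (Real.rpow_le_rpow hx h (by linarith)))]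
    refine (rpow_two_mul_sub_mul_le_of_le hs hx h (by linarith) hz0).trans ?_
    refine mul_le_mul_of_nonneg_left ?_ hC
    have : 0 ≤ x ^ s * z ^ s * y := by positivity
    linarith

end Symbol

section WeightedSchwartz

theorem continuous_rpow_norm_mul_schwartz {E : Type*} [NormedAddCommGroup E]
    [NormedSpace ℝ E] (f : 𝓢(E, ℂ)) {t : ℝ} (ht : 0 ≤ t) :
    Continuous fun ξ : E => ((‖ξ‖ ^ t : ℝ) : ℂ) * f ξ := by
  have h : Continuous fun ξ : E => ‖ξ‖ ^ t := continuous_norm.rpow_const fun _ => Or.inr ht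
  exact (Complex.continuous_ofReal.comp h).mul f.continuous

theorem rpow_norm_le_one_add_pow {E : Type*} [NormedAddCommGroup E] (ξ : E) {t : ℝ}
    (ht : 0 ≤ t) : ‖ξ‖ ^ t ≤ 1 + ‖ξ‖ ^ ⌈t⌉₊ := by
  rcases le_total ‖ξ‖ 1 with h | h
  · have := Real.rpow_le_one (norm_nonneg ξ) h ht
    have : 0 ≤ ‖ξ‖ ^ ⌈t⌉₊ := by positivity
    linarith
  · have := Real.rpow_le_rpow_of_exponent_le h (Nat.le_ceil t)
    rw [Real.rpow_natCast] at this
    linarith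

theorem exists_norm_rpow_norm_mul_schwartz_le {E : Type*} [NormedAddCommGroup E]
    [NormedSpace ℝ E] (f : 𝓢(E, ℂ)) {t : ℝ} (ht : 0 ≤ t) :
    ∃ M : ℝ, ∀ ξ : E, ‖((‖ξ‖ ^ t : ℝ) : ℂ) * f ξ‖ ≤ M := by
  refine ⟨SchwartzMap.seminorm ℝ 0 0 f + SchwartzMap.seminorm ℝ ⌈t⌉₊ 0 f, fun ξ => ?_⟩
  have h1 := SchwartzMap.norm_pow_mul_le_seminorm ℝ f 0 ξ
  have h2 := SchwartzMap.norm_pow_mul_le_seminorm ℝ f ⌈t⌉₊ ξ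
  rw [norm_mul, Complex.norm_real, Real.norm_of_nonneg (by positivity)]
  calc ‖ξ‖ ^ t * ‖f ξ‖ ≤ (1 + ‖ξ‖ ^ ⌈t⌉₊) * ‖f ξ‖ := by
        gcongr
        exact rpow_norm_le_one_add_pow ξ ht
    _ = ‖ξ‖ ^ 0 * ‖f ξ‖ + ‖ξ‖ ^ ⌈t⌉₊ * ‖f ξ‖ := by ring
    _ ≤ _ := add_le_add h1 h2

variable {E : Type*} [NormedAddCommGroup E] [InnerProductSpace ℝ E] [FiniteDimensional ℝ E]
  [MeasurableSpace E] [BorelSpace E]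

theorem integrable_rpow_norm_mul_schwartz (f : 𝓢(E, ℂ)) {t : ℝ} (ht : 0 ≤ t) :
    Integrable fun ξ : E => ((‖ξ‖ ^ t : ℝ) : ℂ) * f ξ := by
  refine Integrable.mono' (g := fun ξ => ‖ξ‖ ^ 0 * ‖f ξ‖ + ‖ξ‖ ^ ⌈t⌉₊ * ‖f ξ‖)
    ((f.integrable_pow_mul volume 0).add (f.integrable_pow_mul volume ⌈t⌉₊))
    (continuous_rpow_norm_mul_schwartz f ht).aestronglyMeasurable
    (Eventually.of_forall fun ξ => ?_)
  rw [norm_mul, Complex.norm_real, Real.norm_of_nonneg (by positivity), ← add_mul, pow_zero]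
  gcongr
  exact rpow_norm_le_one_add_pow ξ ht

theorem memLp_two_rpow_norm_mul_schwartz (f : 𝓢(E, ℂ)) {t : ℝ} (ht : 0 ≤ t) :
    MemLp (fun ξ : E => ((‖ξ‖ ^ t : ℝ) : ℂ) * f ξ) 2 := by
  obtain ⟨M, hM⟩ := exists_norm_rpow_norm_mul_schwartz_le f ht
  have hc := (continuous_rpow_norm_mul_schwartz f ht).aestronglyMeasurable (μ := volume)
  refine (memLp_two_iff_integrable_sq_norm hc).mpr ?_
  have := (integrable_rpow_norm_mul_schwartz f ht).norm.bdd_mul (c := M) hc.norm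
    (Eventually.of_forall fun ξ => by simpa using hM ξ)
  simpa [sq] using this

theorem integrable_rpow_two_mul_norm_mul_sq (f : 𝓢(E, ℂ)) {t : ℝ} (ht : 0 ≤ t) :
    Integrable fun ξ : E => ‖ξ‖ ^ (2 * t) * ‖f ξ‖ ^ 2 := by
  have h := (memLp_two_rpow_norm_mul_schwartz f ht).integrable_norm_pow (by norm_num)
  refine h.congr (Eventually.of_forall fun ξ => ?_)
  simp only [norm_mul, Complex.norm_real, mul_pow, Real.norm_eq_abs, sq_abs]
  rw [← Real.rpow_natCast, ← Real.rpow_mul (norm_nonneg ξ), mul_comm 2 t]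
  norm_num

end WeightedSchwartz

section FourierSide

/-- The `ℓ¹` norm of the vector of values of a family of functions. -/
def valueSum (a : Fin 3 → 𝓢(Ell 3, ℂ)) (ξ : Ell 3) : ℝ := ∑ l, ‖a l ξ‖

/-- The weighted `L²` norm of a family of functions. -/
def weightedNorm (t : ℝ) (a : Fin 3 → 𝓢(Ell 3, ℂ)) : ℝ :=
  Real.sqrt (∑ l, ∫ ξ, ‖ξ‖ ^ (2 * t) * ‖a l ξ‖ ^ 2)

theorem valueSum_nonneg (a : Fin 3 → 𝓢(Ell 3, ℂ)) (ξ : Ell 3) : 0 ≤ valueSum a ξ :=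
  Finset.sum_nonneg fun _ _ => norm_nonneg _

theorem continuous_valueSum (a : Fin 3 → 𝓢(Ell 3, ℂ)) : Continuous (valueSum a) :=
  continuous_finsetSum _ fun l _ => (a l).continuous.norm

theorem lintegral_valueSum_le (a : Fin 3 → 𝓢(Ell 3, ℂ)) {t : ℝ} (ht : 0 ≤ t) :
    (∫⁻ ξ, ENNReal.ofReal (‖ξ‖ ^ t * valueSum a ξ) ^ 2) ^ (1 / 2 : ℝ) ≤
      ENNReal.ofReal (Real.sqrt 3 * weightedNorm t a) := by
  have hint : ∀ l, Integrable fun ξ : Ell 3 => ‖ξ‖ ^ (2 * t) * ‖a l ξ‖ ^ 2 := fun l =>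
    integrable_rpow_two_mul_norm_mul_sq (a l) ht
  have hsum : Integrable fun ξ : Ell 3 => 3 * ∑ l, ‖ξ‖ ^ (2 * t) * ‖a l ξ‖ ^ 2 :=
    (integrable_finsetSum _ fun l _ => hint l).const_mul 3
  have hle : ∫⁻ ξ, ENNReal.ofReal (‖ξ‖ ^ t * valueSum a ξ) ^ 2 ≤
      ENNReal.ofReal (3 * ∑ l, ∫ ξ, ‖ξ‖ ^ (2 * t) * ‖a l ξ‖ ^ 2) := by
    rw [← integral_finsetSum _ fun l _ => hint l, ← integral_const_mul,
      ofReal_integral_eq_lintegral_ofReal hsum (Eventually.of_forall fun ξ => by positivity)]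
    refine lintegral_mono fun ξ => ?_
    have h0 : 0 ≤ ‖ξ‖ ^ t * valueSum a ξ :=
      mul_nonneg (by positivity) (valueSum_nonneg a ξ)
    rw [← ENNReal.ofReal_pow h0]
    refine ENNReal.ofReal_le_ofReal ?_
    have hp : (‖ξ‖ ^ t) ^ 2 = ‖ξ‖ ^ (2 * t) := by
      rw [← Real.rpow_natCast, ← Real.rpow_mul (norm_nonneg ξ), mul_comm]
      norm_num
    rw [mul_pow, hp, ← Finset.mul_sum]
    have hcs : valueSum a ξ ^ 2 ≤ 3 * ∑ l, ‖a l ξ‖ ^ 2 := by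
      simpa [valueSum] using
        sq_sum_le_card_mul_sum_sq (s := Finset.univ) (f := fun l => ‖a l ξ‖)
    calc _ ≤ ‖ξ‖ ^ (2 * t) * (3 * ∑ l, ‖a l ξ‖ ^ 2) := by gcongr
      _ = _ := by ring
  calc _ ≤ (ENNReal.ofReal (3 * ∑ l, ∫ ξ, ‖ξ‖ ^ (2 * t) * ‖a l ξ‖ ^ 2)) ^ (1 / 2 : ℝ) := by
        gcongr
    _ = _ := by
        have h0 : 0 ≤ ∑ l, ∫ ξ, ‖ξ‖ ^ (2 * t) * ‖a l ξ‖ ^ 2 :=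
          Finset.sum_nonneg fun l _ => integral_nonneg fun ξ => by positivity
        rw [ENNReal.ofReal_rpow_of_nonneg (by positivity) (by norm_num), ← Real.sqrt_eq_rpow,
          Real.sqrt_mul (by norm_num), weightedNorm]

/-- The integrand of the nonlinear term on the Fourier side. -/
def nonlinearIntegrand (s : ℝ) (a : Fin 3 → 𝓢(Ell 3, ℂ)) (p : Ell 3 × Ell 3) : ℂ :=
  ((‖p.1‖ ^ (2 * s) : ℝ) : ℂ) * (2 * Real.pi * Complex.I) *
    (∑ i, (p.2 i : ℂ) * a i (p.1 - p.2)) * ∑ l, a l p.2 * a l (-p.1)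

theorem integrable_nonlinearIntegrand {s : ℝ} (hs : 0 ≤ s) (a : Fin 3 → 𝓢(Ell 3, ℂ)) :
    Integrable (nonlinearIntegrand s a) (volume.prod volume) := by
  have hterm : ∀ i l, Integrable (fun p : Ell 3 × Ell 3 =>
      a i (p.1 - p.2) * ((((‖p.1‖ ^ (2 * s) : ℝ) : ℂ) * a l (-p.1)) * ((p.2 i : ℂ) * a l p.2)))
      (volume.prod volume) := by
    intro i l
    have h1 : Integrable fun ξ : Ell 3 => ((‖ξ‖ ^ (2 * s) : ℝ) : ℂ) * a l (-ξ) := by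
      simpa using (integrable_rpow_norm_mul_schwartz (a l) (t := 2 * s) (by positivity)).comp_neg
    have h2 : Integrable fun η : Ell 3 => (η i : ℂ) * a l η := by
      refine Integrable.mono' ((a l).integrable_pow_mul volume 1) ?_
        (Eventually.of_forall fun η => ?_)
      · refine Continuous.aestronglyMeasurable ?_
        have := (a l).continuous
        fun_prop
      · rw [norm_mul, Complex.norm_real, pow_one]
        gcongr
        exact PiLp.norm_apply_le η i
    refine (h1.mul_prod h2).bdd_mul (c := SchwartzMap.seminorm ℝ 0 0 (a i)) ?_
      (Eventually.of_forall fun p => SchwartzMap.norm_le_seminorm ℝ (a i) _)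
    exact ((a i).continuous.comp (continuous_fst.sub continuous_snd)).aestronglyMeasurable
  have hsum := (integrable_finsetSum Finset.univ fun i _ =>
    integrable_finsetSum Finset.univ fun l _ => hterm i l).const_mul (2 * Real.pi * Complex.I)
  refine hsum.congr (Eventually.of_forall fun p => ?_)
  simp only [nonlinearIntegrand, Finset.mul_sum, Finset.sum_mul]
  refine Finset.sum_comm.trans (Finset.sum_congr rfl fun l _ => Finset.sum_congr rfl fun i _ => ?_)
  ring

/-- Symmetrization: a divergence-free field turns the symbol `|ξ|^{2s}` into the difference
`|ξ|^{2s} - |η|^{2s}`. -/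
theorem nonlinearIntegrand_add_reflect {s : ℝ} {a : Fin 3 → 𝓢(Ell 3, ℂ)}
    (hdiv : ∀ ζ : Ell 3, ∑ i, (ζ i : ℂ) * a i ζ = 0) (p : Ell 3 × Ell 3) :
    nonlinearIntegrand s a p + nonlinearIntegrand s a (-p).swap =
      (((‖p.1‖ ^ (2 * s) - ‖p.2‖ ^ (2 * s) : ℝ) : ℂ) * (2 * Real.pi * Complex.I) *
        (∑ i, (p.2 i : ℂ) * a i (p.1 - p.2)) * ∑ l, a l p.2 * a l (-p.1)) := by
  obtain ⟨ξ, η⟩ := p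
  have h := hdiv (ξ - η)
  simp only [PiLp.sub_apply, Complex.ofReal_sub, sub_mul, Finset.sum_sub_distrib] at h
  have h1 : ∑ i, ((-ξ) i : ℂ) * a i (-η - -ξ) = -∑ i, (η i : ℂ) * a i (ξ - η) := by
    rw [← sub_eq_zero.mp h, ← Finset.sum_neg_distrib]
    refine Finset.sum_congr rfl fun i _ => ?_
    rw [show -η - -ξ = ξ - η by abel]
    simp
  have h2 : ∑ l, a l (-ξ) * a l (- -η) = ∑ l, a l η * a l (-ξ) := by
    refine Finset.sum_congr rfl fun l _ => ?_
    rw [neg_neg, mul_comm]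
  simp only [nonlinearIntegrand, Prod.neg_mk, Prod.swap_prod_mk, h1, h2, norm_neg]
  push_cast
  ring

theorem norm_sum_coord_mul_le_min {a : Fin 3 → 𝓢(Ell 3, ℂ)}
    (hdiv : ∀ ζ : Ell 3, ∑ i, (ζ i : ℂ) * a i ζ = 0) (ξ η : Ell 3) :
    ‖∑ i, (η i : ℂ) * a i (ξ - η)‖ ≤ min ‖ξ‖ ‖η‖ * valueSum a (ξ - η) := by
  have hb : ∀ x : Ell 3, ‖∑ i, (x i : ℂ) * a i (ξ - η)‖ ≤ ‖x‖ * valueSum a (ξ - η) := by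
    intro x
    rw [valueSum, Finset.mul_sum]
    refine norm_sum_le_of_le _ fun i _ => ?_
    rw [norm_mul, Complex.norm_real]
    gcongr
    exact PiLp.norm_apply_le x i
  have h := hdiv (ξ - η)
  simp only [PiLp.sub_apply, Complex.ofReal_sub, sub_mul, Finset.sum_sub_distrib] at h
  rcases min_choice ‖ξ‖ ‖η‖ with h' | h' <;> rw [h']
  · rw [← sub_eq_zero.mp h]
    exact hb ξ
  · exact hb η

theorem norm_nonlinearIntegrand_add_reflect_le {s : ℝ} (hs : 1 ≤ s) {a : Fin 3 → 𝓢(Ell 3, ℂ)}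
    (hdiv : ∀ ζ : Ell 3, ∑ i, (ζ i : ℂ) * a i ζ = 0)
    (heven : ∀ l ζ, ‖a l (-ζ)‖ = ‖a l ζ‖) (ξ η : Ell 3) :
    ‖nonlinearIntegrand s a (ξ, η) + nonlinearIntegrand s a (-(ξ, η)).swap‖ ≤
      2 * Real.pi * (s * 2 ^ s) *
        ((‖ξ‖ ^ s * valueSum a ξ) * (‖η‖ ^ s * valueSum a η) * (‖ξ - η‖ * valueSum a (ξ - η)) +
        (‖ξ‖ ^ s * valueSum a ξ) * (‖ξ - η‖ ^ s * valueSum a (ξ - η)) * (‖η‖ * valueSum a η) +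
        (‖η‖ ^ s * valueSum a η) * (‖ξ - η‖ ^ s * valueSum a (ξ - η)) *
          (‖ξ‖ * valueSum a ξ)) := by
  have h1 := norm_sum_coord_mul_le_min hdiv ξ η
  have h2 : ‖∑ l, a l η * a l (-ξ)‖ ≤ valueSum a η * valueSum a ξ := by
    rw [valueSum, Finset.sum_mul]
    refine norm_sum_le_of_le _ fun l _ => ?_
    rw [norm_mul, heven]
    gcongr
    exact Finset.single_le_sum (f := fun l => ‖a l ξ‖) (fun _ _ => norm_nonneg _)
      (Finset.mem_univ l)
  have h3 := abs_rpow_two_mul_sub_mul_min_le hs (norm_nonneg ξ) (norm_nonneg η)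
    (abs_norm_sub_norm_le ξ η)
  have hW := valueSum_nonneg a
  rw [nonlinearIntegrand_add_reflect hdiv]
  simp only [norm_mul, Complex.norm_real, Complex.norm_I, Real.norm_eq_abs,
    abs_of_pos Real.pi_pos, Complex.norm_ofNat, mul_one]
  calc |‖ξ‖ ^ (2 * s) - ‖η‖ ^ (2 * s)| * (2 * Real.pi) * ‖∑ i, (η i : ℂ) * a i (ξ - η)‖ *
        ‖∑ l, a l η * a l (-ξ)‖
      ≤ |‖ξ‖ ^ (2 * s) - ‖η‖ ^ (2 * s)| * (2 * Real.pi) *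
          (min ‖ξ‖ ‖η‖ * valueSum a (ξ - η)) * (valueSum a η * valueSum a ξ) := by
        have := Real.pi_pos
        gcongr
        exact mul_nonneg (by positivity)
          (mul_nonneg (le_min (norm_nonneg _) (norm_nonneg _)) (hW _))
    _ = (|‖ξ‖ ^ (2 * s) - ‖η‖ ^ (2 * s)| * min ‖ξ‖ ‖η‖) *
          (2 * Real.pi * (valueSum a (ξ - η) * valueSum a η * valueSum a ξ)) := by ring
    _ ≤ _ := mul_le_mul_of_nonneg_right h3 (mul_nonneg (by positivity)
          (mul_nonneg (mul_nonneg (hW _) (hW _)) (hW _)))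
    _ = _ := by ring

theorem norm_integral_nonlinearIntegrand_le {s : ℝ} (hs : 1 ≤ s) {a : Fin 3 → 𝓢(Ell 3, ℂ)}
    (hdiv : ∀ ζ : Ell 3, ∑ i, (ζ i : ℂ) * a i ζ = 0)
    (heven : ∀ l ζ, ‖a l (-ζ)‖ = ‖a l ζ‖) :
    ‖∫ p, nonlinearIntegrand s a p ∂(volume.prod volume)‖ ≤
      18 * Real.sqrt 3 * Real.pi * (s * 2 ^ s) * trilinearConst * weightedNorm s a *
        weightedNorm (s + 1) a * weightedNorm (3 / 2) a := by
  have hW := valueSum_nonneg a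
  have hWc := continuous_valueSum a
  have hWneg : ∀ z, valueSum a (-z) = valueSum a z := fun z => by simp [valueSum, heven]
  set A : Ell 3 → ENNReal := fun ξ => ENNReal.ofReal (‖ξ‖ ^ s * valueSum a ξ) with hA
  set b : Ell 3 → ENNReal := fun ξ => ENNReal.ofReal (‖ξ‖ ^ (3 / 2 : ℝ) * valueSum a ξ) with hb
  set B : Ell 3 → ENNReal := fun ξ => ENNReal.ofReal (‖ξ‖ * valueSum a ξ) with hB
  have hAm : Measurable A := by have := hWc.measurable; fun_prop
  have hbm : Measurable b := by have := hWc.measurable; fun_prop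
  have hBm : Measurable B := by have := hWc.measurable; fun_prop
  have hAneg : ∀ z, A (-z) = A z := fun z => by simp [hA, hWneg]
  have hbneg : ∀ z, b (-z) = b z := fun z => by simp [hb, hWneg]
  have hBb : ∀ z, B z = b z * halfKernel z := by
    intro z
    simp only [hB, hb, halfKernel]
    rw [← ENNReal.ofReal_mul (mul_nonneg (by positivity) (hW z))]
    congr 1
    rcases (norm_nonneg z).eq_or_lt with h | h
    · rw [← h, Real.zero_rpow (by norm_num)]
      simp
    · have : ‖z‖ ^ (3 / 2 : ℝ) * ‖z‖ ^ (-(1 / 2) : ℝ) = ‖z‖ := by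
        rw [← Real.rpow_add h]
        norm_num
      linear_combination -valueSum a z * this
  set J : ENNReal := ∫⁻ ξ, ∫⁻ η, A ξ * A η * B (ξ - η) with hJ
  have hJ2 : ∫⁻ ξ, ∫⁻ η, A ξ * A (ξ - η) * B η = J := by
    refine lintegral_congr fun ξ => ?_
    rw [← lintegral_sub_left_eq_self (fun η => A ξ * A η * B (ξ - η)) ξ]
    simp
  have hJ3 : ∫⁻ ξ, ∫⁻ η, A η * A (ξ - η) * B ξ = J := by
    rw [lintegral_lintegral_swap (by fun_prop), ← hJ2]
    refine lintegral_congr fun η => lintegral_congr fun ξ => ?_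
    rw [← hAneg (ξ - η), neg_sub]
  have hJle : J ≤ 2 * (ENNReal.ofReal trilinearConst *
        ENNReal.ofReal (Real.sqrt 3 * weightedNorm (s + 1) a) *
        (ENNReal.ofReal (Real.sqrt 3 * weightedNorm s a) *
          ENNReal.ofReal (Real.sqrt 3 * weightedNorm (3 / 2) a))) := by
    rw [hJ]
    simp_rw [hBb]
    refine (trilinear_le hAm hbm hbneg).trans ?_
    have hA1 : ∀ ξ : Ell 3, ENNReal.ofReal ‖ξ‖ * A ξ =
        ENNReal.ofReal (‖ξ‖ ^ (s + 1) * valueSum a ξ) := by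
      intro ξ
      rw [hA, ← ENNReal.ofReal_mul (norm_nonneg ξ),
        Real.rpow_add_one' (norm_nonneg ξ) (by linarith)]
      congr 1
      ring
    simp_rw [hA1]
    gcongr
    · exact lintegral_valueSum_le a (by linarith)
    · exact lintegral_valueSum_le a (by linarith)
    · exact lintegral_valueSum_le a (by norm_num)
  set I : ℂ := ∫ p, nonlinearIntegrand s a p ∂(volume.prod volume) with hI
  have hint := integrable_nonlinearIntegrand (zero_le_one.trans hs) a
  have : (volume.prod volume : Measure (Ell 3 × Ell 3)).IsNegInvariant :=
    ⟨((Measure.measurePreserving_neg volume).prod (Measure.measurePreserving_neg volume)).map_eq⟩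
  have hI2 : ∫ p, nonlinearIntegrand s a (-p).swap ∂(volume.prod volume) = I := by
    rw [integral_neg_eq_self (fun p : Ell 3 × Ell 3 => nonlinearIntegrand s a p.swap),
      integral_prod_swap]
  have hint2 : Integrable (fun p : Ell 3 × Ell 3 => nonlinearIntegrand s a (-p).swap)
      (volume.prod volume) :=
    hint.swap.comp_neg
  have h2I : 2 * I = ∫ p, (nonlinearIntegrand s a p + nonlinearIntegrand s a (-p).swap)
      ∂(volume.prod volume) := by
    rw [integral_add hint hint2, hI2, two_mul]
  have hK0 : 0 ≤ 2 * Real.pi * (s * 2 ^ s) := by positivity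
  have hT0 : 0 ≤ trilinearConst := Real.sqrt_nonneg _
  have hN : ∀ t, 0 ≤ weightedNorm t a := fun t => Real.sqrt_nonneg _
  have hbound : ‖2 * I‖ₑ ≤ ENNReal.ofReal (2 * Real.pi * (s * 2 ^ s)) * (J + J + J) := by
    rw [h2I]
    refine (enorm_integral_le_lintegral_enorm _).trans ?_
    calc _ ≤ ∫⁻ p : Ell 3 × Ell 3, ENNReal.ofReal (2 * Real.pi * (s * 2 ^ s)) *
          (A p.1 * A p.2 * B (p.1 - p.2) + A p.1 * A (p.1 - p.2) * B p.2 +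
            A p.2 * A (p.1 - p.2) * B p.1) ∂(volume.prod volume) := by
          refine lintegral_mono fun p => ?_
          obtain ⟨ξ, η⟩ := p
          rw [← ofReal_norm]
          refine (ENNReal.ofReal_le_ofReal
            (norm_nonlinearIntegrand_add_reflect_le hs hdiv heven ξ η)).trans (le_of_eq ?_)
          have hP : ∀ z : Ell 3, 0 ≤ ‖z‖ ^ s * valueSum a z := fun z =>
            mul_nonneg (by positivity) (hW z)
          have hQ : ∀ z : Ell 3, 0 ≤ ‖z‖ * valueSum a z := fun z =>
            mul_nonneg (by positivity) (hW z)
          have hR : ∀ x y z : Ell 3, 0 ≤ (‖x‖ ^ s * valueSum a x) * (‖y‖ ^ s * valueSum a y) *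
            (‖z‖ * valueSum a z) := fun x y z => mul_nonneg (mul_nonneg (hP x) (hP y)) (hQ z)
          rw [ENNReal.ofReal_mul hK0, ENNReal.ofReal_add (add_nonneg (hR _ _ _) (hR _ _ _))
            (hR _ _ _), ENNReal.ofReal_add (hR _ _ _) (hR _ _ _)]
          simp only [ENNReal.ofReal_mul (mul_nonneg (hP _) (hP _)), ENNReal.ofReal_mul (hP _),
            hA, hB]
      _ = _ := by
          rw [lintegral_const_mul _ (by fun_prop), lintegral_add_left (by fun_prop),
            lintegral_add_left (by fun_prop), lintegral_prod _ (by fun_prop),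
            lintegral_prod _ (by fun_prop), lintegral_prod _ (by fun_prop)]
          simp only [hJ2, hJ3]
          rfl
  have hfinal : ENNReal.ofReal ‖2 * I‖ ≤ ENNReal.ofReal (2 * Real.pi * (s * 2 ^ s) *
      (3 * (2 * (trilinearConst * (Real.sqrt 3 * weightedNorm (s + 1) a) *
        ((Real.sqrt 3 * weightedNorm s a) * (Real.sqrt 3 * weightedNorm (3 / 2) a)))))) := by
    rw [ofReal_norm]
    refine hbound.trans ?_
    have hN' : ∀ t, 0 ≤ Real.sqrt 3 * weightedNorm t a := fun t =>
      mul_nonneg (Real.sqrt_nonneg _) (hN t)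
    rw [ENNReal.ofReal_mul hK0, ENNReal.ofReal_mul (by norm_num : (0 : ℝ) ≤ 3),
      ENNReal.ofReal_mul (by norm_num : (0 : ℝ) ≤ 2),
      ENNReal.ofReal_mul (mul_nonneg hT0 (hN' _)), ENNReal.ofReal_mul hT0,
      ENNReal.ofReal_mul (hN' s), ENNReal.ofReal_ofNat, ENNReal.ofReal_ofNat]
    gcongr
    calc J + J + J = 3 * J := by ring
      _ ≤ _ := by gcongr
  have hR := (ENNReal.ofReal_le_ofReal_iff (by
    have := hN s
    have := hN (s + 1)
    have := hN (3 / 2)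
    positivity)).mp hfinal
  rw [norm_mul, Complex.norm_ofNat] at hR
  have h3 : Real.sqrt 3 ^ 2 = 3 := Real.sq_sqrt (by norm_num)
  have hexp : 2 * Real.pi * (s * 2 ^ s) *
      (3 * (2 * (trilinearConst * (Real.sqrt 3 * weightedNorm (s + 1) a) *
        ((Real.sqrt 3 * weightedNorm s a) * (Real.sqrt 3 * weightedNorm (3 / 2) a))))) =
      2 * (18 * Real.sqrt 3 * Real.pi * (s * 2 ^ s) * trilinearConst * weightedNorm s a *
        weightedNorm (s + 1) a * weightedNorm (3 / 2) a) := by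
    linear_combination (12 * Real.pi * (s * 2 ^ s) * trilinearConst * weightedNorm (s + 1) a *
      weightedNorm s a * weightedNorm (3 / 2) a * Real.sqrt 3) * h3
  linarith

end FourierSide

section Assembly

open scoped LineDeriv

/-- A real-valued Schwartz function, seen as a complex-valued one. -/
def complexify (f : 𝓢(Ell 3, ℝ)) : 𝓢(Ell 3, ℂ) := f.postcompCLM Complex.ofRealCLM

theorem coe_complexify (f : 𝓢(Ell 3, ℝ)) : ⇑(complexify f) = cf (fun x => f x) := rfl

theorem fourier_lineDeriv_eVec_apply (f : 𝓢(Ell 3, ℂ)) (i : Fin 3) (ξ : Ell 3) :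
    𝓕 (∂_{eVec 3 i} f) ξ = 2 * Real.pi * Complex.I * ξ i * 𝓕 f ξ := by
  rw [SchwartzMap.fourier_lineDerivOp_eq, _root_.smul_apply,
    SchwartzMap.smulLeftCLM_apply_apply (by fun_prop)]
  simp [eVec, EuclideanSpace.inner_single_right, mul_assoc]

theorem norm_fourier_complexify_neg (f : 𝓢(Ell 3, ℝ)) (ξ : Ell 3) :
    ‖𝓕 (complexify f) (-ξ)‖ = ‖𝓕 (complexify f) ξ‖ := by
  have h : 𝓕 (complexify f) (-ξ) = starRingEnd ℂ (𝓕 (complexify f) ξ) := by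
    rw [SchwartzMap.fourier_coe, Real.fourier_eq', Real.fourier_eq', ← integral_conj]
    refine integral_congr_ae (Eventually.of_forall fun x => ?_)
    simp [coe_complexify, cf, ← Complex.exp_conj, Complex.conj_ofNat]
  rw [h, RCLike.norm_conj]

theorem Hnorm_eq_weightedNorm (t : ℝ) (u : Fin 3 → 𝓢(Ell 3, ℝ)) :
    Hnorm t (fun l x => u l x) = weightedNorm t fun l => 𝓕 (complexify (u l)) := by
  simp only [Hnorm, HsqC, weightedNorm, SchwartzMap.fourier_coe, coe_complexify]

theorem DivFree.sum_coord_mul_fourier {u : Fin 3 → 𝓢(Ell 3, ℝ)} (hu : DivFree u) (ξ : Ell 3) :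
    ∑ i, (ξ i : ℂ) * 𝓕 (complexify (u i)) ξ = 0 := by
  have h : ∑ i, ∂_{eVec 3 i} (complexify (u i)) = 0 := by
    ext x
    have hd : ∀ i, fderiv ℝ (complexify (u i)) x (eVec 3 i) =
        ((fderiv ℝ (fun y => u i y) x (eVec 3 i) : ℝ) : ℂ) := fun i => by
      have := (Complex.ofRealCLM.hasFDerivAt.comp x (u i).differentiableAt.hasFDerivAt).fderiv
      exact congrArg (fun L => L (eVec 3 i)) this
    simp only [_root_.sum_apply, SchwartzMap.lineDerivOp_apply_eq_fderiv, hd]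
    rw [← Complex.ofReal_sum, hu x]
    simp
  have h2 := congrArg (fun f : 𝓢(Ell 3, ℂ) => 𝓕 f ξ) h
  have h3 : 𝓕 (∑ i, ∂_{eVec 3 i} (complexify (u i))) =
      ∑ i, 𝓕 (∂_{eVec 3 i} (complexify (u i))) :=
    map_sum (FourierTransform.fourierCLM ℂ 𝓢(Ell 3, ℂ)) _ _
  have h4 : 𝓕 (0 : 𝓢(Ell 3, ℂ)) = 0 := map_zero (FourierTransform.fourierCLM ℂ 𝓢(Ell 3, ℂ))
  simp only [h3, h4, _root_.sum_apply, fourier_lineDeriv_eVec_apply, mul_assoc,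
    ← Finset.mul_sum, _root_.zero_apply] at h2
  simpa using h2

/-- The advection term of a Schwartz vector field, as a Schwartz function. -/
def advection (U : Fin 3 → 𝓢(Ell 3, ℂ)) (l : Fin 3) : 𝓢(Ell 3, ℂ) :=
  ∑ i, SchwartzMap.pairing (ContinuousLinearMap.mul ℂ ℂ) (U i) (∂_{eVec 3 i} (U l))

theorem coe_advection (U : Fin 3 → 𝓢(Ell 3, ℂ)) (l : Fin 3) :
    ⇑(advection U l) = adv (fun i => ⇑(U i)) (fun i => ⇑(U i)) l := by
  ext x
  simp [advection, adv, pd, SchwartzMap.lineDerivOp_apply_eq_fderiv,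
    SchwartzMap.pairing_apply_apply]

theorem fourier_advection (U : Fin 3 → 𝓢(Ell 3, ℂ)) (l : Fin 3) (ξ : Ell 3) :
    𝓕 (advection U l) ξ =
      ∑ i, ∫ η, 𝓕 (U i) (ξ - η) * (2 * Real.pi * Complex.I * η i * 𝓕 (U l) η) := by
  have h : 𝓕 (advection U l) =
      ∑ i, 𝓕 (SchwartzMap.pairing (ContinuousLinearMap.mul ℂ ℂ) (U i) (∂_{eVec 3 i} (U l))) :=
    map_sum (FourierTransform.fourierCLM ℂ 𝓢(Ell 3, ℂ)) _ _
  rw [h, _root_.sum_apply]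
  refine Finset.sum_congr rfl fun i _ => ?_
  simp only [← fourier_lineDeriv_eVec_apply]
  rw [← fourier_schwartz_mul, SchwartzMap.fourier_coe]
  rfl

theorem integrable_convolution_integrand (U : Fin 3 → 𝓢(Ell 3, ℂ)) (i l : Fin 3) (ξ : Ell 3) :
    Integrable fun η =>
      𝓕 (U i) (ξ - η) * (2 * Real.pi * Complex.I * η i * 𝓕 (U l) η) := by
  simp only [← fourier_lineDeriv_eVec_apply]
  refine (𝓕 (∂_{eVec 3 i} (U l))).integrable.bdd_mul
    (c := SchwartzMap.seminorm ℝ 0 0 (𝓕 (U i))) ?_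
    (Eventually.of_forall fun η => SchwartzMap.norm_le_seminorm ℝ (𝓕 (U i)) _)
  exact ((𝓕 (U i)).continuous.comp (continuous_const.sub continuous_id)).aestronglyMeasurable

/-- The nonlinear term written on the Fourier side. -/
theorem Cinner_Lam_advection_eq {s : ℝ} (hs : 0 ≤ s) (U : Fin 3 → 𝓢(Ell 3, ℂ)) :
    Cinner (fun l => Lam s (advection U l)) (fun l => Lam s (U l)) =
      ∫ p, nonlinearIntegrand s (fun l => 𝓕 (U l)) p ∂(volume.prod volume) := by
  have hpair : ∀ l, ∫ x, Lam s (advection U l) x * Lam s (U l) x =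
      ∫ ξ, ((‖ξ‖ ^ (2 * s) : ℝ) : ℂ) * (𝓕 (advection U l) ξ * 𝓕 (U l) (-ξ)) := by
    intro l
    simp only [Lam, ← SchwartzMap.fourier_coe]
    rw [integral_fourierInv_mul_fourierInv (integrable_rpow_norm_mul_schwartz _ hs)
      (memLp_two_rpow_norm_mul_schwartz _ hs) (integrable_rpow_norm_mul_schwartz _ hs)
      (memLp_two_rpow_norm_mul_schwartz _ hs), ← integral_neg_eq_self]
    refine integral_congr_ae (Eventually.of_forall fun ξ => ?_)
    have hp : ‖ξ‖ ^ (2 * s) = ‖ξ‖ ^ s * ‖ξ‖ ^ s := by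
      rw [two_mul, Real.rpow_add_of_nonneg (norm_nonneg ξ) hs hs]
    simp only [norm_neg, neg_neg, hp]
    push_cast
    ring
  have hint : ∀ l, Integrable fun ξ : Ell 3 =>
      ((‖ξ‖ ^ (2 * s) : ℝ) : ℂ) * (𝓕 (advection U l) ξ * 𝓕 (U l) (-ξ)) := by
    intro l
    have h := (integrable_rpow_norm_mul_schwartz (𝓕 (advection U l)) (t := 2 * s)
      (by positivity)).bdd_mul (f := fun ξ => 𝓕 (U l) (-ξ))
      (c := SchwartzMap.seminorm ℝ 0 0 (𝓕 (U l)))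
      ((𝓕 (U l)).continuous.comp continuous_neg).aestronglyMeasurable
      (Eventually.of_forall fun ξ => SchwartzMap.norm_le_seminorm ℝ (𝓕 (U l)) _)
    refine h.congr (Eventually.of_forall fun ξ => ?_)
    simp only
    ring
  simp only [Cinner, hpair]
  rw [← integral_finsetSum _ fun l _ => hint l,
    integral_prod _ (integrable_nonlinearIntegrand hs _)]
  refine integral_congr_ae (Eventually.of_forall fun ξ => ?_)
  have hslice : ∀ η, nonlinearIntegrand s (fun l => 𝓕 (U l)) (ξ, η) =
      ∑ l, ∑ i, (((‖ξ‖ ^ (2 * s) : ℝ) : ℂ) * 𝓕 (U l) (-ξ)) *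
        (𝓕 (U i) (ξ - η) * (2 * Real.pi * Complex.I * η i * 𝓕 (U l) η)) := by
    intro η
    simp only [nonlinearIntegrand, Finset.mul_sum, Finset.sum_mul]
    refine Finset.sum_congr rfl fun l _ => Finset.sum_congr rfl fun i _ => ?_
    ring
  have hI := integrable_convolution_integrand U
  simp only [hslice]
  rw [integral_finsetSum _ fun l _ => integrable_finsetSum _ fun i _ => (hI i l ξ).const_mul _]
  refine Finset.sum_congr rfl fun l _ => ?_
  rw [integral_finsetSum _ fun i _ => (hI i l ξ).const_mul _]
  simp only [integral_const_mul]
  rw [← Finset.mul_sum, fourier_advection]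
  ring

end Assembly

/-- For `s ≥ 1` there is `c > 0` such that for every divergence-free Schwartz
vector field `u : ℝ³ → ℝ³`,
`|⟨Λ^s[(u·∇)u], Λ^s u⟩| ≤ c ‖u‖_{Ḣ^s} ‖u‖_{Ḣ^{s+1}} ‖u‖_{Ḣ^{3/2}}`. -/
theorem nonlinear_inner_estimate_threeD (s : ℝ) (hs : 1 ≤ s) :
    ∃ c > (0 : ℝ), ∀ u : Fin 3 → 𝓢(Ell 3, ℝ), DivFree u →
      ‖Cinner (fun l => Lam s (adv (fun i => cf (u i)) (fun l' => cf (u l')) l))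
          (fun l => Lam s (cf (u l)))‖
        ≤ c * Hnorm s (fun l x => u l x) * Hnorm (s + 1) (fun l x => u l x)
            * Hnorm (3 / 2) (fun l x => u l x) := by
  have hT0 : 0 ≤ trilinearConst := Real.sqrt_nonneg _
  have hK0 : 0 ≤ 18 * Real.sqrt 3 * Real.pi * (s * 2 ^ s) * trilinearConst := by positivity
  refine ⟨18 * Real.sqrt 3 * Real.pi * (s * 2 ^ s) * trilinearConst + 1, by positivity,
    fun u hu => ?_⟩
  have hC := Cinner_Lam_advection_eq (zero_le_one.trans hs) fun l => complexify (u l)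
  simp only [coe_advection, coe_complexify] at hC
  have hmain := norm_integral_nonlinearIntegrand_le hs hu.sum_coord_mul_fourier
    fun l => norm_fourier_complexify_neg (u l)
  rw [← hC] at hmain
  simp only [← Hnorm_eq_weightedNorm] at hmain
  refine hmain.trans ?_
  have hN : ∀ t, 0 ≤ Hnorm t (fun l x => u l x) := fun t => Real.sqrt_nonneg _
  have hN1 := hN s
  have hN2 := hN (s + 1)
  have hN3 := hN (3 / 2)
  gcongr
  linarith

end
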